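/- Let k be a field, let A be a commutative associative k-algebra with a derivation d : A → A, and let (V, ∘) be a Novikov algebra over k, i.e., a k-vector space with a bilinear operation ∘ satisfying (u∘v)∘w = (u∘w)∘v and (u∘v)∘w − u∘(v∘w) = (v∘u)∘w − v∘(u∘w). Define a bilinear bracket on the tensor product A ⊗ V by [a⊗v, b⊗w] = d(a)b ⊗ (v∘w) − d(b)a ⊗ (w∘v). Then this bracket makes A ⊗ V a Lie algebra: it is alternating ([x,x] = 0 for all x ∈ A⊗V) and satisfies the Jacobi identity [[x,y],z] + [[y,z],x] + [[z,x],y] = 0 for all x, y, z ∈ A⊗V. -/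

import Mathlib

open TensorProduct

/-- If `A` is a commutative associative algebra with a derivation `d` and
`(V, ∘)` is a Novikov algebra, then the bilinear bracket on `A ⊗ V` determined by
`[a⊗v, b⊗w] = d(a)b ⊗ (v∘w) − d(b)a ⊗ (w∘v)` is alternating and satisfies the Jacobi
identity, i.e., it makes `A ⊗ V` a Lie algebra. -/
theorem stmt_13 (k : Type*) [Field k]
    (A : Type*) [CommRing A] [Algebra k A]
    (d : A →ₗ[k] A) (hd : ∀ x y : A, d (x * y) = d x * y + x * d y)
    (V : Type*) [AddCommGroup V] [Module k V]
    (circ : V →ₗ[k] V →ₗ[k] V)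
    (h1 : ∀ u v w : V, circ (circ u v) w = circ (circ u w) v)
    (h2 : ∀ u v w : V,
      circ (circ u v) w - circ u (circ v w) = circ (circ v u) w - circ v (circ u w))
    (bracket : (A ⊗[k] V) →ₗ[k] (A ⊗[k] V) →ₗ[k] (A ⊗[k] V))
    (hb : ∀ (a b : A) (v w : V),
      bracket (a ⊗ₜ[k] v) (b ⊗ₜ[k] w)
        = (d a * b) ⊗ₜ[k] (circ v w) - (d b * a) ⊗ₜ[k] (circ w v)) :
    (∀ x : A ⊗[k] V, bracket x x = 0) ∧
    (∀ x y z : A ⊗[k] V,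
      bracket (bracket x y) z + bracket (bracket y z) x + bracket (bracket z x) y = 0) := by
  have double (a b c : A) (v w u : V) :
      bracket (bracket (a ⊗ₜ[k] v) (b ⊗ₜ[k] w)) (c ⊗ₜ[k] u)
        = (d (d a) * b * c) ⊗ₜ[k] circ (circ v w) u + (d a * d b * c) ⊗ₜ[k] circ (circ v w) u
          - (d a * b * d c) ⊗ₜ[k] circ u (circ v w)
          - (a * d (d b) * c) ⊗ₜ[k] circ (circ w v) u - (d a * d b * c) ⊗ₜ[k] circ (circ w v) u
          + (a * d b * d c) ⊗ₜ[k] circ u (circ w v) := by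
    have e1 : d (d a * b) * c = d (d a) * b * c + d a * d b * c := by rw [hd]; ring
    have e2 : d (d b * a) * c = a * d (d b) * c + d a * d b * c := by rw [hd]; ring
    have e3 : d c * (d a * b) = d a * b * d c := by ring
    have e4 : d c * (d b * a) = a * d b * d c := by ring
    rw [hb, map_sub, LinearMap.sub_apply, hb, hb, e1, e2, e3, e4, add_tmul, add_tmul]
    abel
  have jacobi_tmul (a b c : A) (v w u : V) :
      bracket (bracket (a ⊗ₜ[k] v) (b ⊗ₜ[k] w)) (c ⊗ₜ[k] u)
        + bracket (bracket (b ⊗ₜ[k] w) (c ⊗ₜ[k] u)) (a ⊗ₜ[k] v)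
        + bracket (bracket (c ⊗ₜ[k] u) (a ⊗ₜ[k] v)) (b ⊗ₜ[k] w) = 0 := by
    have left_symm (x y z : V) :
        circ x (circ y z) = circ (circ x y) z - circ (circ y x) z + circ y (circ x z) := by
      rw [← sub_add_cancel (circ (circ x y) z) (circ x (circ y z)), h2 x y z]
      abel
    have cycle (x y z : A) : y * z * x = x * y * z := by ring
    have cycle' (x y z : A) : z * x * y = x * y * z := by ring
    simp only [double, cycle a, cycle' _ _ (d c), cycle' _ _ c, cycle' _ _ (d (d c)),
      cycle (d a)]
    rw [h1 v u w, h1 w u v, h1 u w v, left_symm v w u, left_symm w u v, left_symm v u w]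
    simp only [tmul_add, tmul_sub]
    rw [h1 v u w, h1 w u v, h1 u w v]
    abel
  have skew (x y : A ⊗[k] V) : bracket x y + bracket y x = 0 := by
    induction x with
    | zero => simp
    | add x₁ x₂ ih₁ ih₂ =>
      rw [map_add, map_add, LinearMap.add_apply, add_add_add_comm, ih₁, ih₂, add_zero]
    | tmul a v =>
      induction y with
      | zero => simp
      | add y₁ y₂ ih₁ ih₂ =>
        rw [map_add, map_add, LinearMap.add_apply, add_add_add_comm, ih₁, ih₂, add_zero]
      | tmul b w => rw [hb, hb]; abel
  refine ⟨fun x => ?_, fun x y z => ?_⟩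
  · induction x with
    | zero => simp
    | tmul a v => rw [hb, sub_self]
    | add x y hx hy =>
      simp only [map_add, LinearMap.add_apply, hx, hy, zero_add, add_zero]
      rw [add_comm, skew]
  · induction x with
    | zero => simp
    | add x₁ x₂ ih₁ ih₂ =>
      simp only [map_add, LinearMap.add_apply]
      rw [← add_zero (0 : A ⊗[k] V)]
      nth_rewrite 1 [← ih₁]
      rw [← ih₂]
      abel
    | tmul a v =>
      induction y with
      | zero => simp
      | add y₁ y₂ ih₁ ih₂ =>
        simp only [map_add, LinearMap.add_apply]
        rw [← add_zero (0 : A ⊗[k] V)]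
        nth_rewrite 1 [← ih₁]
        rw [← ih₂]
        abel
      | tmul b w =>
        induction z with
        | zero => simp
        | add z₁ z₂ ih₁ ih₂ =>
          simp only [map_add, LinearMap.add_apply]
          rw [← add_zero (0 : A ⊗[k] V)]
          nth_rewrite 1 [← ih₁]
          rw [← ih₂]
          abel
        | tmul c u => exact jacobi_tmul a b c v w u
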